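/- Let k be a field of characteristic p (p prime) and work in p variables, i.e., in Sym_p ⊂ k[x_0,…,x_{p−1}]. Let B = k[e_p^p] denote the k-subalgebra generated by e_p^p (note ∂ vanishes on B). Then: (a) the inclusion B ↪ Sym_p is a quasi-isomorphism of p-complexes, i.e., for every s with 1 ≤ s ≤ p−1: every f ∈ Sym_p with ∂^s f = 0 can be written f = g + ∂^{p−s}(h) with g ∈ B and h ∈ Sym_p, and the only element of B lying in ∂^{p−s}(Sym_p) is 0. (b) For 1 ≤ a ≤ p−1, the twisted p-complex (Sym_p, D_a) with D_a(f) = ∂(f) + a·e_1·f has cohomology B·e_p^{p−a} with zero differential: for every s with 1 ≤ s ≤ p−1, every f ∈ Sym_p with D_a^s f = 0 can be written f = g·e_p^{p−a} + D_a^{p−s}(h) with g ∈ B and h ∈ Sym_p, and if g ∈ B satisfies g·e_p^{p−a} ∈ D_a^{p−s}(Sym_p) then g = 0. -/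

import Mathlib

open MvPolynomial

/-- Modulo a submodule, an operator `T` whose kernel is contained in the image of `T ^ N`. -/
def AcyclicMod {k M : Type*} [CommRing k] [AddCommGroup M] [Module k M]
    (T : Module.End k M) (N : ℕ) (I : Submodule k M) : Prop :=
  ∀ f, T f ∈ I → ∃ h, f - (T ^ N) h ∈ I

lemma pow_apply_mem_of_stable {k M : Type*} [CommRing k] [AddCommGroup M] [Module k M]
    {T : Module.End k M} {I : Submodule k M} (hI : ∀ f ∈ I, T f ∈ I) (s : ℕ) {f : M}
    (hf : f ∈ I) : (T ^ s) f ∈ I := by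
  induction s with
  | zero => simpa using hf
  | succ s ih => rw [pow_succ', Module.End.mul_apply]; exact hI _ ih

lemma AcyclicMod.exists_sub_pow_mem {k M : Type*} [CommRing k] [AddCommGroup M] [Module k M]
    {T : Module.End k M} {N : ℕ} {I : Submodule k M} (hT : AcyclicMod T N I)
    {s : ℕ} (hs : 1 ≤ s) (hsN : s ≤ N) {f : M}
    (hf : (T ^ s) f ∈ I) : ∃ h, f - (T ^ (N + 1 - s)) h ∈ I := by
  induction s, hs using Nat.le_induction generalizing f with
  | base => simpa using hT f (by simpa using hf)
  | succ s hs ih =>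
    rw [pow_succ', Module.End.mul_apply] at hf
    obtain ⟨h, hh⟩ := hT _ hf
    have hsplit : T ^ N = T ^ s * T ^ (N + 1 - (s + 1)) := by
      rw [← pow_add]; congr 1; omega
    rw [hsplit, Module.End.mul_apply, ← map_sub] at hh
    obtain ⟨u, hu⟩ := ih (by omega) hh
    refine ⟨h + T u, ?_⟩
    have hstep : T ^ (N + 1 - s) = T ^ (N + 1 - (s + 1)) * T := by
      rw [← pow_succ]; congr 1; omega
    rw [hstep, Module.End.mul_apply] at hu
    rwa [map_add, ← sub_sub]

namespace TruncatedSymm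

variable (k : Type*) [Field k] (n : ℕ)

/-- The element `e_j` of `k[e_1, …, e_n]`, with `e_0 = 1` and `e_j = 0` for `j > n`. -/
noncomputable def gen : ℕ → MvPolynomial (Fin n) k
  | 0 => 1
  | i + 1 => if h : i < n then X ⟨i, h⟩ else 0

/-- The derivation of `k[e_1, …, e_n]` with `e_j ↦ e_1 e_j - (j + 1) e_{j + 1}`. -/
noncomputable def del : Derivation k (MvPolynomial (Fin n) k) (MvPolynomial (Fin n) k) :=
  mkDerivation k fun i => gen k n 1 * gen k n (i + 1) - C ((i : k) + 2) * gen k n (i + 2)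

/-- The derivation of `k[e_1, …, e_n]` with `e_j ↦ e_{j - q}`, where `e_i = 0` for `i < 0`. -/
noncomputable def lower (q : ℕ) :
    Derivation k (MvPolynomial (Fin n) k) (MvPolynomial (Fin n) k) :=
  mkDerivation k fun i => if q ≤ i + 1 then gen k n (i + 1 - q) else 0

/-- The twisted differential `f ↦ ∂ f + b e_1 f`. -/
noncomputable def twist (b : k) : Module.End k (MvPolynomial (Fin n) k) :=
  (del k n : MvPolynomial (Fin n) k →ₗ[k] MvPolynomial (Fin n) k) +
    b • LinearMap.mulLeft k (gen k n 1)

variable {k n}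

lemma twist_apply (b : k) (f : MvPolynomial (Fin n) k) :
    twist k n b f = del k n f + C b * (gen k n 1 * f) := by
  simp [twist, smul_eq_C_mul]

lemma gen_fin (i : Fin n) : gen k n (i + 1) = X i := by simp [gen]

lemma gen_of_lt {j : ℕ} (hj : n < j) : gen k n j = 0 := by
  obtain _ | i := j
  · omega
  · simp only [gen]; rw [dif_neg (by omega)]

lemma del_gen (j : ℕ) :
    del k n (gen k n j) = gen k n 1 * gen k n j - C ((j : k) + 1) * gen k n (j + 1) := by
  obtain _ | i := j
  · simp [gen]
  · by_cases h : i < n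
    · have := gen_fin (k := k) ⟨i, h⟩
      simp only at this
      rw [this, del, mkDerivation_X, this]
      simp [add_assoc, one_add_one_eq_two]
    · rw [gen_of_lt (j := i + 1) (by omega), gen_of_lt (j := i + 1 + 1) (by omega)]
      simp

lemma lower_gen {q j : ℕ} (hq : 1 ≤ q) (hj : j ≤ n) :
    lower k n q (gen k n j) = if q ≤ j then gen k n (j - q) else 0 := by
  obtain _ | i := j
  · rw [if_neg (by omega)]; simp [gen]
  · have := gen_fin (k := k) ⟨i, hj⟩
    simp only at this
    rw [this, lower, mkDerivation_X]

lemma C_mul_lower_gen {q j : ℕ} (hn : ((n : k) + 1) = 0) (hq : 1 ≤ q) (hj : j ≤ n + 1) :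
    C (j : k) * lower k n q (gen k n j) =
      C (j : k) * if q ≤ j then gen k n (j - q) else 0 := by
  obtain hj | rfl := Nat.le_succ_iff.1 hj
  · rw [lower_gen hq hj]
  · simp [hn]

lemma del_lower (hn : ((n : k) + 1) = 0) {q : ℕ} (hq : 1 ≤ q) (f : MvPolynomial (Fin n) k) :
    del k n (lower k n (q + 1) f) =
      lower k n (q + 1) (del k n f) + C ((q : k) + 1) * lower k n q f := by
  have key : ⁅del k n, lower k n (q + 1)⁆ = ((q : k) + 1) • lower k n q := by
    refine derivation_ext fun i => ?_
    have hi := i.2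
    rw [Derivation.commutator_apply, Derivation.smul_apply, ← gen_fin, smul_eq_C_mul,
      lower_gen (by omega) (by omega), lower_gen (by omega) (by omega), del_gen, map_sub,
      Derivation.leibniz, lower_gen (by omega) (by omega), lower_gen (by omega) (by omega),
      Derivation.leibniz, derivation_C, smul_zero, add_zero, smul_eq_mul, smul_eq_mul,
      smul_eq_mul]
    have := C_mul_lower_gen (k := k) (n := n) (q := q + 1) (j := i + 1 + 1) hn (by omega)
      (by omega)
    simp only [Nat.cast_add, Nat.cast_one] at this ⊢
    rw [this, if_neg (show ¬ q + 1 ≤ 1 by omega)]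
    rcases lt_trichotomy q (i + 1) with h | h | h
    · rw [if_pos (by omega), if_pos (by omega), if_pos (by omega), del_gen]
      obtain ⟨r, hr⟩ : ∃ r, (i : ℕ) = q + r := ⟨i - q, by omega⟩
      rw [hr, show q + r + 1 - (q + 1) = r by omega, show q + r + 1 + 1 - (q + 1) = r + 1 by omega,
        show q + r + 1 - q = r + 1 by omega]
      simp only [map_add, map_natCast, map_one]
      push_cast
      ring
    · rw [if_neg (by omega), if_pos (by omega), if_pos (by omega), h, map_zero]
      simp [gen]
    · rw [if_neg (by omega), if_neg (by omega), if_neg (by omega)]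
      simp
  have := congrArg (fun d => d f) key
  simp only [Derivation.commutator_apply, Derivation.smul_apply, smul_eq_C_mul] at this
  rw [← this]; ring

lemma del_lower_one (hn : ((n : k) + 1) = 0) (f : MvPolynomial (Fin n) k) :
    del k n (lower k n 1 f) = lower k n 1 (del k n f) := by
  have key : ⁅del k n, lower k n 1⁆ = 0 := by
    refine derivation_ext fun i => ?_
    have hi := i.2
    rw [Derivation.commutator_apply, Derivation.zero_apply, ← gen_fin,
      lower_gen (by omega) (by omega), del_gen, map_sub,
      Derivation.leibniz, lower_gen (by omega) (by omega), lower_gen (by omega) (by omega),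
      Derivation.leibniz, derivation_C, smul_zero, add_zero, smul_eq_mul, smul_eq_mul,
      smul_eq_mul]
    have := C_mul_lower_gen (k := k) (n := n) (q := 1) (j := i + 1 + 1) hn (by omega)
      (by omega)
    simp only [Nat.cast_add, Nat.cast_one] at this ⊢
    rw [this, if_pos (by omega), if_pos (by omega), if_pos (by omega)]
    simp only [Nat.add_sub_cancel, del_gen]
    simp [gen]
    ring
  have := congrArg (fun d => d f) key
  simp only [Derivation.commutator_apply, Derivation.zero_apply] at this
  exact sub_eq_zero.1 this

lemma twist_lower (hn : ((n : k) + 1) = 0) (hn1 : 1 ≤ n) (b : k) {q : ℕ} (hq : 1 ≤ q)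
    {f : MvPolynomial (Fin n) k} (hf : twist k n b f = 0) :
    twist k n b (lower k n (q + 1) f) = C ((q : k) + 1) * lower k n q f := by
  have := congrArg (lower k n (q + 1)) hf
  rw [twist_apply, map_add, Derivation.leibniz, Derivation.leibniz, derivation_C,
    lower_gen (by omega) hn1, if_neg (by omega), map_zero] at this
  simp only [smul_eq_mul] at this
  rw [twist_apply, del_lower hn hq]
  linear_combination this

lemma twist_lower_one (hn : ((n : k) + 1) = 0) (hn1 : 1 ≤ n) (b : k)
    {f : MvPolynomial (Fin n) k} (hf : twist k n b f = 0) :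
    twist k n b (lower k n 1 f) = - C b * f := by
  have := congrArg (lower k n 1) hf
  rw [twist_apply, map_add, Derivation.leibniz, Derivation.leibniz, derivation_C,
    lower_gen (by omega) hn1, if_pos (by omega), map_zero] at this
  simp only [smul_eq_mul] at this
  rw [twist_apply, del_lower_one hn]
  rw [Nat.sub_self, show gen k n 0 = 1 from rfl] at this
  linear_combination this

lemma twist_pow_lower (hn : ((n : k) + 1) = 0) (hn1 : 1 ≤ n) (b : k)
    {f : MvPolynomial (Fin n) k} (hf : twist k n b f = 0) (q : ℕ) :
    (twist k n b ^ (q + 1)) (lower k n (q + 1) f) = (-b * ((q + 1).factorial : k)) • f := by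
  induction q with
  | zero => simp [twist_lower_one hn hn1 b hf, smul_eq_C_mul]
  | succ q ih =>
    rw [pow_succ, Module.End.mul_apply, twist_lower hn hn1 b (by omega) hf, ← smul_eq_C_mul,
      map_smul, ih, smul_smul]
    congr 1
    rw [Nat.factorial_succ (q + 1)]
    push_cast
    ring

/-- If `b ≠ 0`, the twisted differential has no cohomology. -/
lemma acyclicMod_bot (hn : ((n : k) + 1) = 0) (hn1 : 1 ≤ n) (hfac : (n.factorial : k) ≠ 0)
    {b : k} (hb : b ≠ 0) : AcyclicMod (twist k n b) n ⊥ := by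
  intro f hf
  rw [Submodule.mem_bot] at hf
  obtain ⟨q, rfl⟩ : ∃ q, n = q + 1 := ⟨n - 1, by omega⟩
  have hc : -b * ((q + 1).factorial : k) ≠ 0 := mul_ne_zero (neg_ne_zero.2 hb) hfac
  refine ⟨(-b * ((q + 1).factorial : k))⁻¹ • lower k (q + 1) (q + 1) f, ?_⟩
  rw [map_smul, twist_pow_lower hn hn1 b hf, smul_smul, inv_mul_cancel₀ hc, one_smul, sub_self]
  exact Submodule.zero_mem _

/-- The ideal of `k[e_1, …, e_n]` generated by the `e_i` with `i > j`. -/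
noncomputable def tail (k : Type*) [Field k] (n j : ℕ) : Ideal (MvPolynomial (Fin n) k) :=
  Ideal.span (X '' {i : Fin n | j ≤ i})

lemma gen_mem_tail {i j : ℕ} (h : j < i) : gen k n i ∈ tail k n j := by
  obtain _ | i := i
  · omega
  · by_cases hi : i < n
    · have := gen_fin (k := k) ⟨i, hi⟩
      simp only at this
      rw [this]
      exact Ideal.subset_span ⟨⟨i, hi⟩, by simpa using Nat.lt_succ_iff.1 h, rfl⟩
    · rw [gen_of_lt (by omega)]; exact zero_mem _

lemma tail_self : tail k n n = ⊥ := by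
  have : {i : Fin n | n ≤ (i : ℕ)} = ∅ := by
    ext i; simp
  simp [tail, this]

lemma tail_succ_le (j : ℕ) : tail k n (j + 1) ≤ tail k n j :=
  Ideal.span_mono (Set.image_mono fun i (hi : j + 1 ≤ (i : ℕ)) => by
    exact show j ≤ (i : ℕ) by omega)

lemma exists_sub_mem_tail_succ {j : ℕ} {f : MvPolynomial (Fin n) k} (hf : f ∈ tail k n j) :
    ∃ g, f - gen k n (j + 1) * g ∈ tail k n (j + 1) := by
  have hle : tail k n j ≤ Ideal.span {gen k n (j + 1)} ⊔ tail k n (j + 1) := by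
    refine Ideal.span_le.2 ?_
    rintro _ ⟨i, hi, rfl⟩
    rcases Nat.eq_or_lt_of_le (show j ≤ (i : ℕ) from hi) with h | h
    · refine Ideal.mem_sup_left (Ideal.subset_span ?_)
      rw [h, gen_fin]; rfl
    · rw [← gen_fin]
      exact Ideal.mem_sup_right (gen_mem_tail (by omega))
  obtain ⟨a, ha, c, hc, rfl⟩ := Submodule.mem_sup.1 (hle hf)
  obtain ⟨g, rfl⟩ := Ideal.mem_span_singleton'.1 ha
  exact ⟨g, by rwa [mul_comm, add_sub_cancel_left]⟩

lemma mem_tail_of_gen_mul_mem {j : ℕ} (hj : j < n) {f : MvPolynomial (Fin n) k}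
    (hf : gen k n (j + 1) * f ∈ tail k n (j + 1)) : f ∈ tail k n (j + 1) := by
  have hX : gen k n (j + 1) = X ⟨j, hj⟩ := gen_fin (k := k) ⟨j, hj⟩
  rw [hX] at hf
  rw [tail, mem_ideal_span_X_image] at hf ⊢
  intro m hm
  obtain ⟨i, hi, hi0⟩ := hf (Finsupp.single ⟨j, hj⟩ 1 + m) (by
    rwa [mem_support_iff, coeff_X_mul, ← mem_support_iff])
  refine ⟨i, hi, ?_⟩
  have hij : (⟨j, hj⟩ : Fin n) ≠ i := by
    rintro rfl
    simp at hi
  simpa [Finsupp.single_apply, hij] using hi0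

lemma del_mem_tail {j : ℕ} {f : MvPolynomial (Fin n) k} (hf : f ∈ tail k n j) :
    del k n f ∈ tail k n j := by
  refine Submodule.span_induction ?_ (by simp) (fun a c _ _ ha hc => ?_)
    (fun a c hc' hc => ?_) hf
  · rintro _ ⟨i, hi, rfl⟩
    have hi' : j ≤ (i : ℕ) := hi
    rw [← gen_fin, del_gen]
    exact sub_mem (Ideal.mul_mem_left _ _ (gen_mem_tail (by omega)))
      (Ideal.mul_mem_left _ _ (gen_mem_tail (by omega)))
  · rw [map_add]; exact add_mem ha hc
  · rw [smul_eq_mul, Derivation.leibniz]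
    exact add_mem (Ideal.mul_mem_left _ _ hc)
      (by rw [smul_eq_mul]; exact Ideal.mul_mem_right _ _ hc')

lemma twist_mem_tail (b : k) {j : ℕ} {f : MvPolynomial (Fin n) k} (hf : f ∈ tail k n j) :
    twist k n b f ∈ tail k n j := by
  rw [twist_apply]
  exact add_mem (del_mem_tail hf) (Ideal.mul_mem_left _ _ (Ideal.mul_mem_left _ _ hf))

lemma twist_gen_mul (b : k) (j : ℕ) (g : MvPolynomial (Fin n) k) :
    twist k n b (gen k n j * g) =
      gen k n j * twist k n (b + 1) g - C ((j : k) + 1) * gen k n (j + 1) * g := by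
  rw [twist_apply, twist_apply, Derivation.leibniz, del_gen]
  simp only [smul_eq_mul, map_add, map_one]
  ring

lemma twist_pow_gen_mul_sub_mem (b : k) (j s : ℕ) (g : MvPolynomial (Fin n) k) :
    (twist k n b ^ s) (gen k n j * g) - gen k n j * (twist k n (b + 1) ^ s) g ∈ tail k n j := by
  induction s with
  | zero => simp
  | succ s ih =>
    rw [pow_succ', pow_succ', Module.End.mul_apply, Module.End.mul_apply]
    have h1 := twist_mem_tail b ih
    rw [map_sub, twist_gen_mul] at h1
    have h2 : C ((j : k) + 1) * gen k n (j + 1) * (twist k n (b + 1) ^ s) g ∈ tail k n j :=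
      Ideal.mul_mem_right _ _ (Ideal.mul_mem_left _ _ (gen_mem_tail (by omega)))
    convert sub_mem h1 h2 using 1
    ring

/-- The ideal `tail k n j` as a `k`-subspace. -/
noncomputable def tailSubmodule (k : Type*) [Field k] (n j : ℕ) :
    Submodule k (MvPolynomial (Fin n) k) := (tail k n j).restrictScalars k

lemma mem_tailSubmodule {j : ℕ} {f : MvPolynomial (Fin n) k} :
    f ∈ tailSubmodule k n j ↔ f ∈ tail k n j := Iff.rfl

/-- Two-out-of-three for `0 → Λ_{j+1}(b + 1) → Λ_{j+1}(b) → Λ_j(b) → 0`. -/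
lemma acyclicMod_tail_of_succ {j : ℕ} (hj : j < n) (hn1 : 1 ≤ n) {b : k}
    (hpow : twist k n b ^ (n + 1) = 0)
    (h₀ : AcyclicMod (twist k n b) n (tailSubmodule k n (j + 1)))
    (h₁ : AcyclicMod (twist k n (b + 1)) n (tailSubmodule k n (j + 1))) :
    AcyclicMod (twist k n b) n (tailSubmodule k n j) := by
  intro f hf
  obtain ⟨g, hg⟩ := exists_sub_mem_tail_succ hf
  have hstable : ∀ c : k, ∀ f ∈ tailSubmodule k n (j + 1),
      twist k n c f ∈ tailSubmodule k n (j + 1) := fun c f hf => twist_mem_tail c hf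
  have hker : (twist k n (b + 1) ^ n) g ∈ tail k n (j + 1) := by
    refine mem_tail_of_gen_mul_mem hj ?_
    have h2 := pow_apply_mem_of_stable (hstable b) n hg
    rw [map_sub, ← Module.End.mul_apply, ← pow_succ, hpow, LinearMap.zero_apply,
      zero_sub] at h2
    have h3 := twist_pow_gen_mul_sub_mem b (j + 1) n g
    rw [mem_tailSubmodule] at h2
    have h4 := neg_mem (add_mem h2 h3)
    convert h4 using 1
    ring
  obtain ⟨h, hh⟩ := h₁.exists_sub_pow_mem hn1 le_rfl hker
  simp only [Nat.add_sub_cancel_left, pow_one] at hh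
  obtain ⟨u, hu⟩ := h₀ (f - gen k n (j + 1) * h) (by
    have h3 := twist_pow_gen_mul_sub_mem b (j + 1) 1 h
    rw [pow_one, pow_one] at h3
    rw [map_sub]
    have h4 := sub_mem (add_mem hg (Ideal.mul_mem_left _ (gen k n (j + 1)) hh)) h3
    rw [mem_tailSubmodule]
    convert h4 using 1
    ring)
  refine ⟨u, ?_⟩
  have h5 := add_mem (tail_succ_le j hu)
    (Ideal.mul_mem_right h _ (gen_mem_tail (k := k) (n := n) (Nat.lt_succ_self j)))
  rw [mem_tailSubmodule]
  convert h5 using 1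
  ring

lemma acyclicMod_tail (hn : ((n : k) + 1) = 0) (hn1 : 1 ≤ n) (hfac : (n.factorial : k) ≠ 0)
    (hpow : ∀ b : ℕ, twist k n (b : k) ^ (n + 1) = 0) {j : ℕ} (hj : j ≤ n) {b : ℕ} (hb : 1 ≤ b)
    (hbj : b ≤ j) : AcyclicMod (twist k n (b : k)) n (tailSubmodule k n j) := by
  induction hj using Nat.decreasingInduction generalizing b with
  | self =>
    have hbot : tailSubmodule k n n = ⊥ := by simp [tailSubmodule, tail_self]
    rw [hbot]
    refine acyclicMod_bot hn hn1 hfac fun h => hfac ?_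
    obtain ⟨c, hc⟩ := Nat.dvd_factorial hb hbj
    rw [hc, Nat.cast_mul, h, zero_mul]
  | of_succ j hj ih =>
    refine acyclicMod_tail_of_succ hj hn1 (hpow b) (ih hb (by omega)) ?_
    exact_mod_cast ih (b := b + 1) (by omega) (by omega)

/-- Modulo `tail k n j`, the cohomology of the untwisted differential is spanned by `1`. -/
lemma exists_sub_C_sub_mem_tail (hn : ((n : k) + 1) = 0) (hn1 : 1 ≤ n)
    (hfac : (n.factorial : k) ≠ 0)
    (hpow : ∀ b : ℕ, twist k n (b : k) ^ (n + 1) = 0) {j : ℕ} (hj : j ≤ n)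
    {f : MvPolynomial (Fin n) k} (hf : twist k n 0 f ∈ tail k n j) :
    ∃ c h, f - C c - (twist k n 0 ^ n) h ∈ tail k n j := by
  induction j generalizing f with
  | zero =>
    refine ⟨constantCoeff f, 0, ?_⟩
    rw [map_zero, sub_zero, tail, mem_ideal_span_X_image]
    intro m hm
    by_contra! hcon
    have hm0 : m = 0 := by ext i; simpa using hcon i (by simp)
    rw [hm0, mem_support_iff] at hm
    simp [constantCoeff_eq] at hm
  | succ j ih =>
    obtain ⟨c, h, hh⟩ := ih (by omega) (tail_succ_le j hf)
    obtain ⟨g, hg⟩ := exists_sub_mem_tail_succ hh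
    have hA := acyclicMod_tail hn hn1 hfac hpow hj (b := 1) le_rfl (by omega)
    rw [Nat.cast_one] at hA
    obtain ⟨u, hu⟩ := hA g (by
      refine mem_tail_of_gen_mul_mem (by omega) ?_
      have h1 := twist_mem_tail 0 hg
      have hC : twist k n 0 (C c) = 0 := by simp [twist_apply]
      have hp0 := hpow 0
      rw [Nat.cast_zero] at hp0
      rw [map_sub, map_sub, map_sub, hC, sub_zero, ← Module.End.mul_apply, ← pow_succ', hp0,
        LinearMap.zero_apply, sub_zero] at h1
      have h3 := twist_pow_gen_mul_sub_mem 0 (j + 1) 1 g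
      rw [pow_one, pow_one, zero_add] at h3
      have h4 := sub_mem (sub_mem hf h1) h3
      convert h4 using 1
      ring)
    refine ⟨c, h + gen k n (j + 1) * u, ?_⟩
    have h3 := twist_pow_gen_mul_sub_mem 0 (j + 1) n u
    rw [zero_add] at h3
    have h4 := sub_mem (add_mem hg (Ideal.mul_mem_left _ (gen k n (j + 1)) hu)) h3
    rw [map_add]
    convert h4 using 1
    ring

lemma constantCoeff_twist (b : k) (f : MvPolynomial (Fin n) k) :
    constantCoeff (twist k n b f) = 0 := by
  have hgen : ∀ i : ℕ, 1 ≤ i → constantCoeff (gen k n i) = 0 := by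
    intro i hi
    obtain ⟨i, rfl⟩ : ∃ r, i = r + 1 := ⟨i - 1, by omega⟩
    simp only [gen]
    split_ifs <;> simp
  rw [twist_apply, map_add, map_mul, map_mul, hgen 1 le_rfl, zero_mul, mul_zero, add_zero]
  induction f using MvPolynomial.induction_on with
  | C a => simp
  | add f g hf hg => rw [map_add, map_add, hf, hg, add_zero]
  | mul_X f i hf =>
    rw [Derivation.leibniz, ← gen_fin, del_gen]
    simp [hf, hgen]

/-- The cohomology of the twisted differential is spanned by `1` if `b = 0`, and vanishes
otherwise. -/
lemma exists_eq_C_add_pow (hn : ((n : k) + 1) = 0) (hn1 : 1 ≤ n)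
    (hfac : (n.factorial : k) ≠ 0) (hpow : ∀ b : ℕ, twist k n (b : k) ^ (n + 1) = 0) (b : k)
    {s : ℕ} (hs : 1 ≤ s) (hsn : s ≤ n) {f : MvPolynomial (Fin n) k}
    (hf : (twist k n b ^ s) f = 0) :
    ∃ c h, f = C c + (twist k n b ^ (n + 1 - s)) h ∧ (b ≠ 0 → c = 0) := by
  by_cases hb : b = 0
  · subst hb
    have hA : AcyclicMod (twist k n 0) n
        (LinearMap.range (Algebra.linearMap k (MvPolynomial (Fin n) k))) := by
      rintro f ⟨c, hc⟩
      have hc0 : c = 0 := by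
        have := congrArg constantCoeff hc
        simpa [constantCoeff_twist, algebraMap_eq] using this
      subst hc0
      obtain ⟨c, h, hh⟩ := exists_sub_C_sub_mem_tail hn hn1 hfac hpow le_rfl (f := f) (by
        rw [← hc]; simp)
      rw [tail_self, Ideal.mem_bot] at hh
      refine ⟨h, c, ?_⟩
      simp only [Algebra.linearMap_apply, algebraMap_eq]
      linear_combination -hh
    obtain ⟨h, c, hc⟩ := hA.exists_sub_pow_mem hs hsn (f := f) (by rw [hf]; exact zero_mem _)
    refine ⟨c, h, ?_, fun h => absurd rfl h⟩
    simp only [Algebra.linearMap_apply, algebraMap_eq] at hc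
    rw [hc]; ring
  · obtain ⟨h, hh⟩ := (acyclicMod_bot hn hn1 hfac hb).exists_sub_pow_mem hs hsn
      (f := f) (by rw [hf]; exact zero_mem _)
    rw [Submodule.mem_bot, sub_eq_zero] at hh
    exact ⟨0, h, by simpa using hh, fun _ => rfl⟩

end TruncatedSymm

section SquareDerivation

variable {σ k : Type*}

lemma derivation_prod_X [CommRing k] {D : Derivation k (MvPolynomial σ k) (MvPolynomial σ k)}
    (hD : ∀ i, D (X i) = X i ^ 2) (A : Finset σ) :
    D (∏ i ∈ A, X i) = (∑ i ∈ A, X i) * ∏ i ∈ A, X i := by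
  classical
  induction A using Finset.induction_on with
  | empty => simp
  | insert a A ha ih =>
    rw [Finset.prod_insert ha, Finset.sum_insert ha, Derivation.leibniz, ih, hD, smul_eq_mul,
      smul_eq_mul]
    ring

lemma sum_powersetCard_sum_compl_prod [Fintype σ] [DecidableEq σ] {R : Type*} [CommRing R]
    (x : σ → R) (j : ℕ) :
    ∑ A ∈ Finset.powersetCard j Finset.univ, ∑ i ∈ Aᶜ, x i * ∏ l ∈ A, x l =
      ((j : R) + 1) * ∑ A ∈ Finset.powersetCard (j + 1) Finset.univ, ∏ l ∈ A, x l := by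
  have hcard : ((j : R) + 1) * ∑ A ∈ Finset.powersetCard (j + 1) Finset.univ, ∏ l ∈ A, x l =
      ∑ A ∈ Finset.powersetCard (j + 1) Finset.univ, ∑ _i ∈ A, ∏ l ∈ A, x l := by
    rw [Finset.mul_sum]
    refine Finset.sum_congr rfl fun A hA => ?_
    rw [Finset.sum_const, (Finset.mem_powersetCard.1 hA).2, nsmul_eq_mul]
    push_cast
    rfl
  rw [hcard, Finset.sum_sigma', Finset.sum_sigma']
  refine Finset.sum_bij' (fun a _ => ⟨insert a.2 a.1, a.2⟩) (fun a _ => ⟨a.1.erase a.2, a.2⟩)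
    ?_ ?_ ?_ ?_ ?_
  · rintro ⟨A, i⟩ h
    simp only [Finset.mem_sigma, Finset.mem_powersetCard_univ, Finset.mem_compl] at h ⊢
    exact ⟨by rw [Finset.card_insert_of_notMem h.2, h.1], Finset.mem_insert_self _ _⟩
  · rintro ⟨A, i⟩ h
    simp only [Finset.mem_sigma, Finset.mem_powersetCard_univ, Finset.mem_compl] at h ⊢
    exact ⟨by rw [Finset.card_erase_of_mem h.2, h.1]; rfl, Finset.notMem_erase _ _⟩
  · rintro ⟨A, i⟩ h
    simp only [Finset.mem_sigma, Finset.mem_compl] at h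
    simp [Finset.erase_insert h.2]
  · rintro ⟨A, i⟩ h
    simp only [Finset.mem_sigma] at h
    simp [Finset.insert_erase h.2]
  · rintro ⟨A, i⟩ h
    simp only [Finset.mem_sigma, Finset.mem_compl] at h
    simp [Finset.prod_insert h.2]

lemma derivation_esymm [Fintype σ] [CommRing k]
    {D : Derivation k (MvPolynomial σ k) (MvPolynomial σ k)}
    (hD : ∀ i, D (X i) = X i ^ 2) (j : ℕ) :
    D (esymm σ k j) = esymm σ k 1 * esymm σ k j - C ((j : k) + 1) * esymm σ k (j + 1) := by
  classical
  have h := sum_powersetCard_sum_compl_prod (X : σ → MvPolynomial σ k) j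
  simp only [map_add, map_natCast, map_one, esymm_one]
  rw [esymm, esymm, ← h, map_sum, Finset.mul_sum, ← Finset.sum_sub_distrib]
  refine Finset.sum_congr rfl fun A _ => ?_
  rw [derivation_prod_X hD, ← Finset.sum_mul, ← Finset.sum_add_sum_compl A]
  ring

lemma derivation_rename [CommRing k] {D : Derivation k (MvPolynomial σ k) (MvPolynomial σ k)}
    (hD : ∀ i, D (X i) = X i ^ 2) (e : Equiv.Perm σ) (f : MvPolynomial σ k) :
    D (rename e f) = rename e (D f) := by
  induction f using MvPolynomial.induction_on with
  | C a => simp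
  | add f g hf hg => simp [hf, hg]
  | mul_X f i hf => simp [Derivation.leibniz, hf, hD]

/-- The Leibniz rule for the `p`-th iterate of a derivation in characteristic `p`. -/
lemma derivation_iterate_char_mul {A : Type*} [Field k] [CommRing A] [Algebra k A] [Nontrivial A]
    (p : ℕ) [Fact p.Prime] [CharP k p] (D : Derivation k A A) (f g : A) :
    D^[p] (f * g) = D^[p] f * g + f * D^[p] g := by
  let T : Module.End k A := (D : A →ₗ[k] A)
  have hT : ∀ m : ℕ, ∀ x, (T ^ m) x = D^[m] x := fun m x => by
    rw [Module.End.pow_apply]; rfl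
  have : CharP (Module.End k (Module.End k A)) p :=
    charP_of_injective_algebraMap (algebraMap k (Module.End k (Module.End k A))).injective p
  have hcomm : Commute (LinearMap.mulLeft k T) (LinearMap.mulRight k T) :=
    LinearMap.commute_mulLeft_right T T
  have had : ∀ m : ℕ, ((LinearMap.mulLeft k T - LinearMap.mulRight k T) ^ m)
      (LinearMap.mulLeft k f) = LinearMap.mulLeft k (D^[m] f) := by
    intro m
    induction m with
    | zero => simp
    | succ m ih =>
      rw [pow_succ', Module.End.mul_apply, ih, Function.iterate_succ_apply']
      ext x
      simp only [LinearMap.sub_apply, LinearMap.mulLeft_apply, LinearMap.mulRight_apply,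
        Module.End.mul_apply, T, Derivation.coeFn_coe, Derivation.leibniz, smul_eq_mul]
      ring
  have h := had p
  have hsub : (LinearMap.mulLeft k T - LinearMap.mulRight k T) ^ p =
      LinearMap.mulLeft k T ^ p - LinearMap.mulRight k T ^ p :=
    sub_pow_char_of_commute (R := Module.End k (Module.End k A)) p hcomm
  rw [hsub, LinearMap.pow_mulLeft, LinearMap.pow_mulRight] at h
  have h2 := LinearMap.congr_fun h g
  simp only [LinearMap.sub_apply, LinearMap.mulLeft_apply, LinearMap.mulRight_apply,
    Module.End.mul_apply, hT] at h2
  rw [← h2]; ring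

lemma derivation_iterate_X [CommRing k] {D : Derivation k (MvPolynomial σ k) (MvPolynomial σ k)}
    (hD : ∀ i, D (X i) = X i ^ 2) (i : σ) (m : ℕ) :
    D^[m] (X i) = C (m.factorial : k) * X i ^ (m + 1) := by
  induction m with
  | zero => simp
  | succ m ih =>
    rw [Function.iterate_succ_apply', ih, Derivation.leibniz, Derivation.leibniz_pow, hD,
      derivation_C, Nat.factorial_succ]
    simp
    ring

lemma derivation_iterate_char [Field k] (p : ℕ) [Fact p.Prime] [CharP k p]
    {D : Derivation k (MvPolynomial σ k) (MvPolynomial σ k)}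
    (hD : ∀ i, D (X i) = X i ^ 2) (f : MvPolynomial σ k) : D^[p] f = 0 := by
  have hp := (Fact.out : p.Prime)
  induction f using MvPolynomial.induction_on with
  | C a =>
    obtain ⟨m, hm⟩ : ∃ m, p = m + 1 := ⟨p - 1, by have := hp.pos; omega⟩
    rw [hm, Function.iterate_succ_apply, derivation_C, iterate_map_zero]
  | add f g hf hg => rw [iterate_map_add, hf, hg, add_zero]
  | mul_X f i hf =>
    rw [derivation_iterate_char_mul, hf, derivation_iterate_X hD,
      (CharP.cast_eq_zero_iff k p _).2 (hp.dvd_factorial.2 le_rfl)]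
    simp

end SquareDerivation

section Diagonal

variable {k : Type*} [Field k] {p : ℕ}

/-- Evaluation of a polynomial at the point all of whose coordinates are `t`. -/
noncomputable def diag (k : Type*) [Field k] (p : ℕ) :
    MvPolynomial (Fin p) k →ₐ[k] Polynomial k := aeval fun _ => Polynomial.X

lemma diag_rename (e : Equiv.Perm (Fin p)) (f : MvPolynomial (Fin p) k) :
    diag k p (rename e f) = diag k p f := by
  rw [diag, aeval_rename]; rfl

lemma diag_pderiv_of_isSymmetric {f : MvPolynomial (Fin p) k} (hf : f.IsSymmetric)
    (i j : Fin p) : diag k p (pderiv i f) = diag k p (pderiv j f) := by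
  have h := pderiv_rename (R := k) (f := Equiv.swap i j) (Equiv.injective _) i f
  rw [hf, Equiv.swap_apply_left] at h
  rw [← diag_rename (Equiv.swap i j) (pderiv i f), ← h]

lemma derivation_eq_sum_pderiv {D : Derivation k (MvPolynomial (Fin p) k) (MvPolynomial (Fin p) k)}
    (hD : ∀ i, D (X i) = X i ^ 2) (f : MvPolynomial (Fin p) k) :
    D f = ∑ i, X i ^ 2 * pderiv i f := by
  induction f using MvPolynomial.induction_on with
  | C a => simp
  | add f g hf hg => simp only [map_add, hf, hg, mul_add, Finset.sum_add_distrib]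
  | mul_X f j hf =>
    simp only [Derivation.leibniz, hf, hD, smul_eq_mul, mul_add, Finset.sum_add_distrib,
      Finset.mul_sum, pderiv_X, Pi.single_apply]
    congr 1
    · simp [mul_comm]
    · exact Finset.sum_congr rfl fun i _ => by ring

lemma diag_derivation_of_isSymmetric [CharP k p]
    {D : Derivation k (MvPolynomial (Fin p) k) (MvPolynomial (Fin p) k)}
    (hD : ∀ i, D (X i) = X i ^ 2) {f : MvPolynomial (Fin p) k} (hf : f.IsSymmetric) :
    diag k p (D f) = 0 := by
  obtain _ | p := p
  · rw [derivation_eq_sum_pderiv hD]; simp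
  have h : ∀ i, diag k (p + 1) (X i ^ 2 * pderiv i f) =
      Polynomial.X ^ 2 * diag k (p + 1) (pderiv 0 f) := fun i => by
    rw [map_mul, diag_pderiv_of_isSymmetric hf i 0, map_pow]
    simp [diag]
  rw [derivation_eq_sum_pderiv hD, map_sum, Finset.sum_congr rfl fun i _ => h i,
    Finset.sum_const, Finset.card_univ, Fintype.card_fin, nsmul_eq_mul, CharP.cast_eq_zero,
    zero_mul]

lemma diag_esymm_self : diag k p (esymm (Fin p) k p) = Polynomial.X ^ p := by
  have h : Finset.powersetCard p (Finset.univ : Finset (Fin p)) = {Finset.univ} := by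
    simpa using Finset.powersetCard_self (Finset.univ : Finset (Fin p))
  simp [esymm, h, diag]

lemma diag_esymm_one [CharP k p] : diag k p (esymm (Fin p) k 1) = 0 := by
  simp [diag]

lemma eq_zero_of_mem_adjoin_of_diag_eq_zero (hp : 0 < p) {g : MvPolynomial (Fin p) k}
    (hg : g ∈ Algebra.adjoin k {esymm (Fin p) k p ^ p}) (h : diag k p g = 0) : g = 0 := by
  rw [Algebra.adjoin_singleton_eq_range_aeval] at hg
  obtain ⟨q, rfl⟩ := hg
  have hq : Polynomial.expand k (p * p) q = 0 := by
    rw [← h, AlgHom.toRingHom_eq_coe, RingHom.coe_coe, ← Polynomial.aeval_algHom_apply, map_pow,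
      diag_esymm_self, ← pow_mul, Polynomial.expand_eq_comp_X_pow]
    rfl
  rw [(Polynomial.expand_eq_zero (by positivity)).1 hq, map_zero]

end Diagonal

section Transfer

open TruncatedSymm

variable {k : Type*} [Field k] {n : ℕ}

/-- The embedding of `k[e_1, …, e_n]` into the symmetric polynomials in `n + 1` variables. -/
noncomputable def toSymm (k : Type*) [Field k] (n : ℕ) :
    MvPolynomial (Fin n) k →ₐ[k] MvPolynomial (Fin (n + 1)) k :=
  (symmetricSubalgebra (Fin (n + 1)) k).val.comp (esymmAlgHom (Fin (n + 1)) k n)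

/-- The twisted differential `f ↦ D f + a e_1 f` attached to a derivation `D`. -/
noncomputable def twistedDerivation {σ : Type*} [Fintype σ]
    (D : Derivation k (MvPolynomial σ k) (MvPolynomial σ k)) (a : k) :
    Module.End k (MvPolynomial σ k) :=
  (D : MvPolynomial σ k →ₗ[k] MvPolynomial σ k) + a • LinearMap.mulLeft k (esymm σ k 1)

lemma twistedDerivation_apply {σ : Type*} [Fintype σ]
    (D : Derivation k (MvPolynomial σ k) (MvPolynomial σ k)) (a : k) (f : MvPolynomial σ k) :
    twistedDerivation D a f = D f + C a * (esymm σ k 1 * f) := by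
  simp [twistedDerivation, smul_eq_C_mul]

lemma toSymm_X (i : Fin n) : toSymm k n (X i) = esymm (Fin (n + 1)) k (i + 1) := by
  simp [toSymm, esymmAlgHom_apply]

lemma toSymm_C (c : k) : toSymm k n (C c) = C c := (toSymm k n).commutes c

lemma toSymm_injective : Function.Injective (toSymm k n) :=
  Subtype.val_injective.comp (esymmAlgHom_fin_injective k (Nat.le_succ n))

lemma toSymm_isSymmetric (f : MvPolynomial (Fin n) k) : (toSymm k n f).IsSymmetric :=
  (esymmAlgHom (Fin (n + 1)) k n f).2

lemma toSymm_gen {j : ℕ} (hj : j ≤ n) :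
    toSymm k n (gen k n j) = esymm (Fin (n + 1)) k j := by
  obtain _ | i := j
  · simp [gen]
  · have := gen_fin (k := k) ⟨i, hj⟩
    simp only at this
    rw [this, toSymm_X]

variable {D : Derivation k (MvPolynomial (Fin (n + 1)) k) (MvPolynomial (Fin (n + 1)) k)}

lemma derivation_toSymm (hn : ((n : k) + 1) = 0) (hD : ∀ i, D (X i) = X i ^ 2)
    (f : MvPolynomial (Fin n) k) : D (toSymm k n f) = toSymm k n (del k n f) := by
  induction f using MvPolynomial.induction_on with
  | C a => simp
  | add f g hf hg => simp only [map_add, hf, hg]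
  | mul_X f i hf =>
    have hi := i.2
    have hX : D (toSymm k n (X i)) = toSymm k n (del k n (X i)) := by
      rw [← gen_fin, del_gen, map_sub, map_mul, map_mul, toSymm_gen (by omega),
        toSymm_gen (by omega), derivation_esymm hD, toSymm_C]
      congr 1
      rcases Nat.lt_or_ge (i + 1) n with h | h
      · rw [toSymm_gen (by omega)]
      · have h' : (i : ℕ) + 1 = n := by omega
        rw [h', hn]; simp
    simp only [map_mul, Derivation.leibniz, map_add, smul_eq_mul, hf, hX]

lemma derivation_esymm_top_pow (hD : ∀ i, D (X i) = X i ^ 2) (c : ℕ) :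
    D (esymm (Fin (n + 1)) k (n + 1) ^ c) =
      C (c : k) * esymm (Fin (n + 1)) k 1 * esymm (Fin (n + 1)) k (n + 1) ^ c := by
  have htop : esymm (Fin (n + 1)) k (n + 1 + 1) = 0 := by
    rw [esymm, Finset.powersetCard_eq_empty.2 (by simp), Finset.sum_empty]
  obtain _ | c := c
  · simp
  · rw [Derivation.leibniz_pow, derivation_esymm hD, htop]
    simp
    ring

lemma twistedDerivation_toSymm_mul (hn : ((n : k) + 1) = 0) (hn1 : 1 ≤ n)
    (hD : ∀ i, D (X i) = X i ^ 2) (a : k) (c : ℕ) (f : MvPolynomial (Fin n) k) :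
    twistedDerivation D a (toSymm k n f * esymm (Fin (n + 1)) k (n + 1) ^ c) =
      toSymm k n (twist k n (a + c) f) * esymm (Fin (n + 1)) k (n + 1) ^ c := by
  rw [twistedDerivation_apply, twist_apply, Derivation.leibniz, derivation_esymm_top_pow hD,
    derivation_toSymm hn hD]
  simp only [map_add, map_mul, toSymm_gen hn1, toSymm_C, smul_eq_mul]
  ring

lemma twistedDerivation_pow_toSymm_mul (hn : ((n : k) + 1) = 0) (hn1 : 1 ≤ n)
    (hD : ∀ i, D (X i) = X i ^ 2) (a : k) (c s : ℕ) (f : MvPolynomial (Fin n) k) :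
    (twistedDerivation D a ^ s) (toSymm k n f * esymm (Fin (n + 1)) k (n + 1) ^ c) =
      toSymm k n ((twist k n (a + c) ^ s) f) * esymm (Fin (n + 1)) k (n + 1) ^ c := by
  induction s generalizing f with
  | zero => simp
  | succ s ih =>
    rw [pow_succ, pow_succ, Module.End.mul_apply, Module.End.mul_apply,
      twistedDerivation_toSymm_mul hn hn1 hD, ih]

lemma twistedDerivation_zero : twistedDerivation D 0 = (D : _ →ₗ[k] _) := by
  simp [twistedDerivation]

lemma esymm_top_ne_zero : esymm (Fin (n + 1)) k (n + 1) ≠ 0 := fun h => by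
  have := diag_esymm_self (k := k) (p := n + 1)
  rw [h, map_zero] at this
  exact pow_ne_zero _ Polynomial.X_ne_zero this.symm

lemma twist_pow_char [Fact (n + 1).Prime] [CharP k (n + 1)] (hn1 : 1 ≤ n) (b : ℕ) :
    twist k n (b : k) ^ (n + 1) = 0 := by
  let D : Derivation k (MvPolynomial (Fin (n + 1)) k) (MvPolynomial (Fin (n + 1)) k) :=
    mkDerivation k fun i => X i ^ 2
  have hD : ∀ i, D (X i) = X i ^ 2 := mkDerivation_X k _
  have hn : ((n : k) + 1) = 0 := by exact_mod_cast CharP.cast_eq_zero k (n + 1)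
  refine LinearMap.ext fun f => ?_
  have h := twistedDerivation_pow_toSymm_mul hn hn1 hD 0 b (n + 1) f
  rw [twistedDerivation_zero, Module.End.pow_apply, zero_add] at h
  have h0 : D^[n + 1] (toSymm k n f * esymm (Fin (n + 1)) k (n + 1) ^ b) = 0 :=
    derivation_iterate_char (n + 1) hD _
  rw [Derivation.coeFn_coe, h0] at h
  refine toSymm_injective ?_
  rw [LinearMap.zero_apply, map_zero]
  exact (mul_eq_zero.1 h.symm).resolve_right (pow_ne_zero _ esymm_top_ne_zero)

/-- The map `k[e_1, …, e_n][e_{n + 1}] → k[x_0, …, x_n]`. -/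
noncomputable def polyToSymm (k : Type*) [Field k] (n : ℕ) :
    Polynomial (MvPolynomial (Fin n) k) →ₐ[k] MvPolynomial (Fin (n + 1)) k :=
  Polynomial.aevalTower (toSymm k n) (esymm (Fin (n + 1)) k (n + 1))

lemma polyToSymm_monomial (c : ℕ) (f : MvPolynomial (Fin n) k) :
    polyToSymm k n (Polynomial.monomial c f) =
      toSymm k n f * esymm (Fin (n + 1)) k (n + 1) ^ c := by
  rw [← Polynomial.C_mul_X_pow_eq_monomial, map_mul, map_pow, polyToSymm,
    Polynomial.aevalTower_C, Polynomial.aevalTower_X]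

lemma polyToSymm_optionEquivLeft (G : MvPolynomial (Option (Fin n)) k) :
    polyToSymm k n (optionEquivLeft k (Fin n) G) =
      esymmAlgHom (Fin (n + 1)) k (n + 1) (rename finSuccEquivLast.symm G) := by
  have h : (polyToSymm k n).comp (optionEquivLeft k (Fin n)).toAlgHom =
      ((symmetricSubalgebra (Fin (n + 1)) k).val.comp (esymmAlgHom (Fin (n + 1)) k (n + 1))).comp
        (rename finSuccEquivLast.symm) := by
    refine MvPolynomial.algHom_ext fun i => ?_
    cases i with
    | none => simp [polyToSymm, esymmAlgHom_apply]
    | some i => simp [polyToSymm, esymmAlgHom_apply, toSymm_X]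
  exact congrArg (fun φ => φ G) h

lemma polyToSymm_injective : Function.Injective (polyToSymm k n) := by
  intro F G h
  obtain ⟨F, rfl⟩ := (optionEquivLeft k (Fin n)).surjective F
  obtain ⟨G, rfl⟩ := (optionEquivLeft k (Fin n)).surjective G
  rw [polyToSymm_optionEquivLeft, polyToSymm_optionEquivLeft] at h
  rw [rename_injective _ (Equiv.injective _)
    ((esymmAlgHom_fin_bijective k (n + 1)).1 (Subtype.val_injective h))]

lemma exists_polyToSymm_eq {f : MvPolynomial (Fin (n + 1)) k} (hf : f.IsSymmetric) :
    ∃ F, polyToSymm k n F = f := by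
  obtain ⟨G, hG⟩ := (esymmAlgHom_fin_bijective k (n + 1)).2 ⟨f, hf⟩
  refine ⟨optionEquivLeft k (Fin n) (rename finSuccEquivLast G), ?_⟩
  rw [polyToSymm_optionEquivLeft, rename_rename]
  simp [hG]

lemma polyToSymm_eq_sum (F : Polynomial (MvPolynomial (Fin n) k)) :
    polyToSymm k n F = ∑ c ∈ F.support,
      toSymm k n (F.coeff c) * esymm (Fin (n + 1)) k (n + 1) ^ c := by
  conv_lhs => rw [F.as_sum_support]
  simp only [map_sum, polyToSymm_monomial]

lemma eq_zero_of_sum_toSymm_mul_eq_zero {S : Finset ℕ} {u : ℕ → MvPolynomial (Fin n) k}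
    (h : ∑ c ∈ S, toSymm k n (u c) * esymm (Fin (n + 1)) k (n + 1) ^ c = 0) {c : ℕ}
    (hc : c ∈ S) : u c = 0 := by
  simp only [← polyToSymm_monomial, ← map_sum] at h
  have h0 := congrArg (fun F => F.coeff c) (polyToSymm_injective (h.trans (map_zero _).symm))
  simpa [Polynomial.finsetSum_coeff, Polynomial.coeff_monomial, hc] using h0

lemma exists_eq_mul_add_twistedDerivation_pow [Fact (n + 1).Prime] [CharP k (n + 1)]
    (hn1 : 1 ≤ n) (hD : ∀ i, D (X i) = X i ^ 2) {a r : ℕ} (hr : r < n + 1) (har : n + 1 ∣ a + r)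
    {s : ℕ} (hs : 1 ≤ s) (hsn : s ≤ n) {f : MvPolynomial (Fin (n + 1)) k} (hf : f.IsSymmetric)
    (hker : (twistedDerivation D (a : k) ^ s) f = 0) :
    ∃ g ∈ Algebra.adjoin k {esymm (Fin (n + 1)) k (n + 1) ^ (n + 1)},
      ∃ h : MvPolynomial (Fin (n + 1)) k, h.IsSymmetric ∧
        f = g * esymm (Fin (n + 1)) k (n + 1) ^ r +
          (twistedDerivation D (a : k) ^ (n + 1 - s)) h := by
  have hn : ((n : k) + 1) = 0 := by exact_mod_cast CharP.cast_eq_zero k (n + 1)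
  have hfac : (n.factorial : k) ≠ 0 := by
    rw [Ne, CharP.cast_eq_zero_iff k (n + 1), (Fact.out : (n + 1).Prime).dvd_factorial]
    omega
  obtain ⟨F, rfl⟩ := exists_polyToSymm_eq hf
  rw [polyToSymm_eq_sum, map_sum] at hker
  simp only [twistedDerivation_pow_toSymm_mul hn hn1 hD] at hker
  have hcoeff : ∀ c ∈ F.support, (twist k n ((a : k) + c) ^ s) (F.coeff c) = 0 := fun c hc =>
    eq_zero_of_sum_toSymm_mul_eq_zero hker hc
  have hsol : ∀ c : ℕ, ∃ (b : k) (h : MvPolynomial (Fin n) k), c ∈ F.support →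
      F.coeff c = C b + (twist k n ((a : k) + c) ^ (n + 1 - s)) h ∧
        ((a : k) + c ≠ 0 → b = 0) := by
    intro c
    by_cases hc : c ∈ F.support
    · obtain ⟨b, h, hbh⟩ := exists_eq_C_add_pow hn hn1 hfac (twist_pow_char hn1) _ hs hsn
        (hcoeff c hc)
      exact ⟨b, h, fun _ => hbh⟩
    · exact ⟨0, 0, fun h => absurd h hc⟩
  choose b h hbh using hsol
  refine ⟨∑ c ∈ F.support, C (b c) *
      (esymm (Fin (n + 1)) k (n + 1) ^ (n + 1)) ^ ((c - r) / (n + 1)), ?_,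
    ∑ c ∈ F.support, toSymm k n (h c) * esymm (Fin (n + 1)) k (n + 1) ^ c, ?_, ?_⟩
  · refine Subalgebra.sum_mem _ fun c _ => Subalgebra.mul_mem _ ?_ (Subalgebra.pow_mem _ ?_ _)
    · rw [← algebraMap_eq]
      exact Subalgebra.algebraMap_mem _ _
    · exact Algebra.subset_adjoin (Set.mem_singleton _)
  · rw [← mem_symmetricSubalgebra]
    refine Subalgebra.sum_mem _ fun c _ => Subalgebra.mul_mem _ ?_ (Subalgebra.pow_mem _ ?_ _)
    · rw [mem_symmetricSubalgebra]
      exact toSymm_isSymmetric _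
    · rw [mem_symmetricSubalgebra]
      exact esymm_isSymmetric _ _ _
  · rw [polyToSymm_eq_sum, map_sum, Finset.sum_mul, ← Finset.sum_add_distrib]
    refine Finset.sum_congr rfl fun c hc => ?_
    obtain ⟨h1, h2⟩ := hbh c hc
    rw [twistedDerivation_pow_toSymm_mul hn hn1 hD, h1, map_add, add_mul, toSymm_C]
    congr 1
    by_cases hac : (a : k) + c = 0
    · rw [mul_assoc, ← pow_mul, ← pow_add]
      have hdvd : n + 1 ∣ a + c := by
        rw [← CharP.cast_eq_zero_iff k (n + 1)]; exact_mod_cast hac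
      have hrc : r ≤ c := by
        by_contra! hlt
        have h3 : n + 1 ∣ r - c := by
          have := Nat.dvd_sub har hdvd
          rwa [Nat.add_sub_add_left] at this
        have := Nat.le_of_dvd (by omega) h3
        omega
      have h3 : n + 1 ∣ c - r := by
        have := Nat.dvd_sub hdvd har
        rwa [Nat.add_sub_add_left] at this
      rw [Nat.mul_div_cancel' h3, Nat.sub_add_cancel hrc]
    · rw [h2 hac]; simp

lemma twistedDerivation_isSymmetric {p : ℕ}
    {D : Derivation k (MvPolynomial (Fin p) k) (MvPolynomial (Fin p) k)}
    (hD : ∀ i, D (X i) = X i ^ 2) (a : k) {f : MvPolynomial (Fin p) k} (hf : f.IsSymmetric) :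
    (twistedDerivation D a f).IsSymmetric := by
  intro e
  rw [twistedDerivation_apply, map_add, ← derivation_rename hD, map_mul, map_mul, hf,
    rename_esymm, rename_C]

lemma eq_zero_of_twistedDerivation_pow_eq {p : ℕ} [CharP k p] (hp : 0 < p)
    {D : Derivation k (MvPolynomial (Fin p) k) (MvPolynomial (Fin p) k)}
    (hD : ∀ i, D (X i) = X i ^ 2) (a : k) (r : ℕ) {s : ℕ} (hs : 1 ≤ s)
    {g h : MvPolynomial (Fin p) k} (hg : g ∈ Algebra.adjoin k {esymm (Fin p) k p ^ p})
    (hh : h.IsSymmetric)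
    (hgh : (twistedDerivation D a ^ s) h = g * esymm (Fin p) k p ^ r) : g = 0 := by
  refine eq_zero_of_mem_adjoin_of_diag_eq_zero hp hg ?_
  have hsymm : ∀ m, ((twistedDerivation D a ^ m) h).IsSymmetric := by
    intro m
    induction m with
    | zero => simpa using hh
    | succ m ih =>
      rw [pow_succ', Module.End.mul_apply]; exact twistedDerivation_isSymmetric hD a ih
  obtain ⟨m, rfl⟩ : ∃ m, s = m + 1 := ⟨s - 1, by omega⟩
  have h0 := congrArg (diag k p) hgh
  rw [pow_succ', Module.End.mul_apply, twistedDerivation_apply, map_add,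
    diag_derivation_of_isSymmetric hD (hsymm m), map_mul, map_mul, diag_esymm_one, zero_mul,
    mul_zero, add_zero, map_mul, map_pow, diag_esymm_self] at h0
  exact (mul_eq_zero.1 h0.symm).resolve_right
    (pow_ne_zero _ (pow_ne_zero _ Polynomial.X_ne_zero))

end Transfer

/-- In `p` variables: (a) the inclusion of `B = k[e_p^p]` (with zero differential) into
`Sym_p` is a quasi-isomorphism of `p`-complexes; (b) for `1 ≤ a ≤ p-1`, the twisted
`p`-complex `(Sym_p, D_a)` has cohomology `B · e_p^{p-a}` with zero differential. -/
theorem stmt7 (p : ℕ) (hp : p.Prime) (k : Type*) [Field k] [CharP k p]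
    (D : Derivation k (MvPolynomial (Fin p) k) (MvPolynomial (Fin p) k))
    (hD : ∀ i, D (X i) = X i ^ 2)
    (B : Subalgebra k (MvPolynomial (Fin p) k))
    (hB : B = Algebra.adjoin k {esymm (Fin p) k p ^ p}) :
    (∀ s : ℕ, 1 ≤ s → s ≤ p - 1 →
      (∀ f : MvPolynomial (Fin p) k, f.IsSymmetric → (⇑D)^[s] f = 0 →
        ∃ g ∈ B, ∃ h : MvPolynomial (Fin p) k, h.IsSymmetric ∧ f = g + (⇑D)^[p - s] h) ∧
      (∀ g ∈ B, (∃ h : MvPolynomial (Fin p) k, h.IsSymmetric ∧ (⇑D)^[p - s] h = g) → g = 0)) ∧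
    (∀ a : ℕ, 1 ≤ a → a ≤ p - 1 →
      ∀ Da : MvPolynomial (Fin p) k → MvPolynomial (Fin p) k,
        (∀ f, Da f = D f + (a : MvPolynomial (Fin p) k) * (esymm (Fin p) k 1 * f)) →
        ∀ s : ℕ, 1 ≤ s → s ≤ p - 1 →
          (∀ f : MvPolynomial (Fin p) k, f.IsSymmetric → Da^[s] f = 0 →
            ∃ g ∈ B, ∃ h : MvPolynomial (Fin p) k, h.IsSymmetric ∧
              f = g * esymm (Fin p) k p ^ (p - a) + Da^[p - s] h) ∧
          (∀ g ∈ B, (∃ h : MvPolynomial (Fin p) k, h.IsSymmetric ∧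
              Da^[p - s] h = g * esymm (Fin p) k p ^ (p - a)) → g = 0)) := by
  subst hB
  have hp2 := hp.two_le
  obtain ⟨n, rfl⟩ : ∃ n, p = n + 1 := ⟨p - 1, by omega⟩
  have : Fact (n + 1).Prime := ⟨hp⟩
  have hcoh : ∀ (a r : ℕ), r < n + 1 → n + 1 ∣ a + r →
      ∀ Da : MvPolynomial (Fin (n + 1)) k → MvPolynomial (Fin (n + 1)) k,
      (∀ f, Da f = D f + (a : MvPolynomial (Fin (n + 1)) k) *
        (esymm (Fin (n + 1)) k 1 * f)) →
      ∀ s : ℕ, 1 ≤ s → s ≤ n + 1 - 1 →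
        (∀ f : MvPolynomial (Fin (n + 1)) k, f.IsSymmetric → Da^[s] f = 0 →
          ∃ g ∈ Algebra.adjoin k {esymm (Fin (n + 1)) k (n + 1) ^ (n + 1)},
            ∃ h : MvPolynomial (Fin (n + 1)) k, h.IsSymmetric ∧
              f = g * esymm (Fin (n + 1)) k (n + 1) ^ r + Da^[n + 1 - s] h) ∧
        (∀ g ∈ Algebra.adjoin k {esymm (Fin (n + 1)) k (n + 1) ^ (n + 1)},
          (∃ h : MvPolynomial (Fin (n + 1)) k, h.IsSymmetric ∧
            Da^[n + 1 - s] h = g * esymm (Fin (n + 1)) k (n + 1) ^ r) → g = 0) := by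
    intro a r hr har Da hDa s hs hsn
    obtain rfl : Da = twistedDerivation D (a : k) := funext fun f => by
      rw [hDa, twistedDerivation_apply, map_natCast]
    simp only [← Module.End.pow_apply]
    refine ⟨fun f hf hker => ?_, ?_⟩
    · exact exists_eq_mul_add_twistedDerivation_pow (by omega) hD hr har hs (by omega) hf hker
    · rintro g hg ⟨h, hh, hgh⟩
      exact eq_zero_of_twistedDerivation_pow_eq (by omega) hD _ r (by omega) hg hh hgh
  refine ⟨fun s hs hsn => ?_, fun a ha han Da hDa s hs hsn => ?_⟩
  · simpa using hcoh 0 0 (by omega) (by simp) D (by simp) s hs hsn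
  · exact hcoh a (n + 1 - a) (by omega) (by rw [Nat.add_sub_cancel' (by omega)]) Da hDa s hs hsn
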